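/- arXiv:1108.6295 — 2 statements merged into one kernel-verified Lean document; each statement's English description precedes it below -/
import Mathlib

section
/- Let l ≥ 1 and n ≥ 3 be integers, and let W be a word over the alphabet {1,…,l} that is not strongly n-divisible over the set Z of all noncyclic words of length 3 (with boundary 2n). Then every family of pairwise disjoint occurrences in W of subwords of the form z^m, where z is a noncyclic word of length 3 and m > 2n, such that no two of the periods z are cyclic rotations of each other, has at most (2l−1)(n−1)(n−2) members. -/
/-- `u` is lexicographically greater than `v`: at the first position where they
differ, `u` has the larger letter (words where one is a prefix of the other are
incomparable). -/
def WordGt {α : Type*} [LinearOrder α] (u v : List α) : Prop :=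
  List.Lex (· < ·) v u ∧ ¬ v <+: u

/-- `wpow z k` is the concatenation of `k` copies of the word `z`. -/
def wpow {α : Type*} (z : List α) : ℕ → List α
  | 0 => []
  | k + 1 => z ++ wpow z k

/-- A word is noncyclic (primitive) if it is nonempty and is not a proper power. -/
def Noncyclic {α : Type*} (z : List α) : Prop :=
  z ≠ [] ∧ ∀ (v : List α) (k : ℕ), 2 ≤ k → z ≠ wpow v k

/-- `W` is `n`-divisible: `W = W₀W₁⋯Wₙ` with `W₁,…,Wₙ` nonempty and in strictly
decreasing lexicographic order. -/
def NDivisible {α : Type*} [LinearOrder α] (W : List α) (n : ℕ) : Prop :=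
  ∃ (W₀ : List α) (f : Fin n → List α),
    W = W₀ ++ (List.ofFn f).flatten ∧
    (∀ i, f i ≠ []) ∧
    (∀ i j, i < j → WordGt (f i) (f j))

/-- `W` is strongly `n`-divisible over the set of words `Z` (with boundary `2n`):
it is `n`-divisible with each `Wᵢ` (`1 ≤ i ≤ n`) beginning with `zᵢ^{2n}` for
pairwise distinct `z₁,…,zₙ ∈ Z`. -/
def StronglyNDivisible {α : Type*} [LinearOrder α] (W : List α) (n : ℕ)
    (Z : Set (List α)) : Prop :=
  ∃ (W₀ : List α) (f : Fin n → List α) (z : Fin n → List α),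
    W = W₀ ++ (List.ofFn f).flatten ∧
    (∀ i, f i ≠ []) ∧
    (∀ i j, i < j → WordGt (f i) (f j)) ∧
    (∀ i, z i ∈ Z ∧ wpow (z i) (2 * n) <+: f i) ∧
    Function.Injective z

/-- `u` occurs as a subword of `W` starting at position `p`. -/
def OccursAt {α : Type*} (W u : List α) (p : ℕ) : Prop :=
  ∃ pre suf : List α, pre.length = p ∧ W = pre ++ u ++ suf

/-- `Lex3 a b c a' b' c'`: the word `abc` is lexicographically smaller than `a'b'c'`. -/
abbrev Lex3 (a b c a' b' c' : ℕ) : Prop :=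
  a < a' ∨ a = a' ∧ (b < b' ∨ b = b' ∧ c < c')

/-- A family of cyclic words of length 3 over the letters `0, …, l - 1`, met at distinct times,
whose rotations are coloured with `K` colours. Words of one colour increase with time, a word of
colour `0` exceeds all earlier words, and the rotations of one cyclic word are coloured
antitonically. -/
structure ColoredWords (ι : Type*) (l K : ℕ) where
  time : ι → ℕ
  letter : ι → Fin 3 → ℕ
  color : ι → Fin 3 → ℕ
  time_injective : Function.Injective time
  letter_lt : ∀ i s, letter i s < l
  color_lt : ∀ i s, color i s < K
  not_const : ∀ i, ¬ (letter i 0 = letter i 1 ∧ letter i 1 = letter i 2)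
  lex_of_color_eq : ∀ i j s t, time i < time j → color i s = color j t →
    Lex3 (letter i s) (letter i (s + 1)) (letter i (s + 2))
      (letter j t) (letter j (t + 1)) (letter j (t + 2))
  lex_of_color_zero : ∀ i j s t, time i < time j → color j t = 0 →
    Lex3 (letter i s) (letter i (s + 1)) (letter i (s + 2))
      (letter j t) (letter j (t + 1)) (letter j (t + 2))
  color_anti : ∀ i s t,
    Lex3 (letter i s) (letter i (s + 1)) (letter i (s + 2))
      (letter i t) (letter i (t + 1)) (letter i (t + 2)) → color i t ≤ color i s

namespace ColoredWords

variable {ι : Type*} {l K : ℕ} (C : ColoredWords ι l K)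

/-- `abc` is a rotation of the `i`-th word, and `abc`, `bca`, `cab` have colours `p`, `q`, `r`. -/
def Rot (i : ι) (a b c p q r : ℕ) : Prop :=
  ∃ s, C.letter i s = a ∧ C.letter i (s + 1) = b ∧ C.letter i (s + 2) = c ∧
    C.color i s = p ∧ C.color i (s + 1) = q ∧ C.color i (s + 2) = r

variable {C} {i j k : ι} {a b c p q r a' b' c' p' q' r' x y x' y' v : ℕ}

theorem Rot.rotate (h : C.Rot i a b c p q r) : C.Rot i b c a q r p := by
  obtain ⟨s, h1, h2, h3, h4, h5, h6⟩ := h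
  refine ⟨s + 1, ?_⟩
  fin_cases s <;> exact ⟨h2, h3, h1, h5, h6, h4⟩

theorem exists_rot (C : ColoredWords ι l K) (i : ι) : ∃ a b c p q r, C.Rot i a b c p q r :=
  ⟨_, _, _, _, _, _, 0, rfl, rfl, rfl, rfl, rfl, rfl⟩

theorem Rot.eq_or_rotate (h : C.Rot i a b c p q r) (h' : C.Rot i a' b' c' p' q' r') :
    (a = a' ∧ b = b' ∧ c = c' ∧ p = p' ∧ q = q' ∧ r = r') ∨
    (b = a' ∧ c = b' ∧ a = c' ∧ q = p' ∧ r = q' ∧ p = r') ∨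
    (c = a' ∧ a = b' ∧ b = c' ∧ r = p' ∧ p = q' ∧ q = r') := by
  obtain ⟨s, rfl, rfl, rfl, rfl, rfl, rfl⟩ := h
  obtain ⟨t, rfl, rfl, rfl, rfl, rfl, rfl⟩ := h'
  have ht : t = s ∨ t = s + 1 ∨ t = s + 2 := by revert s t; decide
  rcases ht with rfl | rfl | rfl
  · simp
  · right; left
    fin_cases s <;> simp
  · right; right
    fin_cases s <;> simp

theorem Rot.lex (h : C.Rot i a b c p q r) (h' : C.Rot j a' b' c' p q' r')
    (hij : C.time i < C.time j) : Lex3 a b c a' b' c' := by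
  obtain ⟨s, rfl, rfl, rfl, rfl, rfl, rfl⟩ := h
  obtain ⟨t, rfl, rfl, rfl, hp, rfl, rfl⟩ := h'
  exact C.lex_of_color_eq i j s t hij hp.symm

theorem Rot.lex_zero (h : C.Rot i a b c p q r) (h' : C.Rot j a' b' c' 0 q' r')
    (hij : C.time i < C.time j) : Lex3 a b c a' b' c' := by
  obtain ⟨s, rfl, rfl, rfl, rfl, rfl, rfl⟩ := h
  obtain ⟨t, rfl, rfl, rfl, hp, rfl, rfl⟩ := h'
  exact C.lex_of_color_zero i j s t hij hp

theorem Rot.color_anti (h : C.Rot i a b c p q r) (h' : C.Rot i a' b' c' p' q' r')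
    (hl : Lex3 a b c a' b' c') : p' ≤ p := by
  obtain ⟨s, rfl, rfl, rfl, rfl, rfl, rfl⟩ := h
  obtain ⟨t, rfl, rfl, rfl, rfl, rfl, rfl⟩ := h'
  exact C.color_anti i s t hl

theorem Rot.letter_lt (h : C.Rot i a b c p q r) : a < l := by
  obtain ⟨s, rfl, -⟩ := h
  exact C.letter_lt i s

theorem Rot.color_lt (h : C.Rot i a b c p q r) : p < K := by
  obtain ⟨s, -, -, -, rfl, -⟩ := h
  exact C.color_lt i s

theorem Rot.not_const (h : C.Rot i a b c p q r) : ¬ (a = b ∧ b = c) := by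
  have h0 := C.not_const i
  obtain ⟨s, rfl, rfl, rfl, -⟩ := h
  fin_cases s <;> simp at h0 ⊢ <;> grind

theorem time_trichotomy (C : ColoredWords ι l K) (i j : ι) :
    C.time i < C.time j ∨ i = j ∨ C.time j < C.time i := by
  rcases lt_trichotomy (C.time i) (C.time j) with h | h | h
  · exact Or.inl h
  · exact Or.inr (Or.inl (C.time_injective h))
  · exact Or.inr (Or.inr h)

variable (C) in
/-- A consecutive pair of letters `a`, `b` in the `i`-th cyclic word, together with the colours of
the rotations that begin with them. -/
def Edge (i : ι) (p q a b : ℕ) : Prop := ∃ c r, C.Rot i a b c p q r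

variable (C) in
/-- No word later than the `i`-th one has the given edge. -/
def Final (i : ι) (p q a b : ℕ) : Prop :=
  ∀ j, C.time i < C.time j → ¬ C.Edge j p q a b

/-- The pairs of colours whose edges are counted. -/
def Allowed (p q : ℕ) : Prop := q ≠ 0 ∧ ¬ (p = 1 ∧ q = 1)

variable (C) in
/-- The `i`-th word is not the last one on any of its allowed edges. -/
def Unassigned (i : ι) : Prop :=
  ∀ p q a b, Allowed p q → C.Edge i p q a b → ¬ C.Final i p q a b

theorem Unassigned.exists_later (hX : C.Unassigned i) (h : C.Rot i a b c p q r)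
    (hpq : Allowed p q) :
    ∃ j c' r', C.time i < C.time j ∧ C.Rot j a b c' p q r' ∧ c < c' := by
  have := hX p q a b hpq ⟨c, r, h⟩
  simp only [Final, Edge, not_forall, not_not] at this
  obtain ⟨j, hij, c', r', hj⟩ := this
  have := h.lex hj hij
  exact ⟨j, c', r', hij, hj, by omega⟩

/-- A word with no colour `0` cannot fail to be last on all three edges. -/
theorem Unassigned.not_all_allowed (hX : C.Unassigned i) (h : C.Rot i a b c p q r)
    (h1 : Allowed p q) (h2 : Allowed q r) (h3 : Allowed r p) : False := by
  obtain ⟨j, c', u, -, hj, hc⟩ := hX.exists_later h h1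
  obtain ⟨k, a', v, -, hk, ha⟩ := hX.exists_later h.rotate h2
  obtain ⟨m, b', w, -, hm, hb⟩ := hX.exists_later h.rotate.rotate h3
  have hjk : C.time k ≤ C.time j := by
    by_contra! hlt
    have := hj.rotate.lex hk hlt
    omega
  have hkm : C.time m ≤ C.time k := by
    by_contra! hlt
    have := hk.rotate.lex hm hlt
    omega
  have hmj : C.time j ≤ C.time m := by
    by_contra! hlt
    have := hm.rotate.lex hj hlt
    omega
  obtain rfl : k = j := C.time_injective (by omega)
  obtain rfl : m = k := C.time_injective (by omega)
  have e1 := hj.eq_or_rotate hk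
  have e2 := hk.eq_or_rotate hm
  have := h.not_const
  omega

/-- The same with exactly one rotation of colour `0`. -/
theorem Unassigned.not_one_zero (hX : C.Unassigned i) (h : C.Rot i a b c 0 q r)
    (hq : q ≠ 0) (h2 : Allowed q r) : False := by
  obtain ⟨j, c', u, -, hj, hc⟩ := hX.exists_later h ⟨hq, by omega⟩
  obtain ⟨k, a', v, -, hk, ha⟩ := hX.exists_later h.rotate h2
  rcases C.time_trichotomy j k with hjk | rfl | hkj
  · have := hj.rotate.lex hk hjk
    omega
  · have e1 := hj.eq_or_rotate hk
    have h3 := hj.rotate.rotate.color_anti hj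
    have h4 := hj.color_anti hj.rotate
    have := h.not_const
    omega
  · have := hk.rotate.rotate.lex_zero hj hkj
    omega

variable (C) in
/-- The `i`-th word moves the first letter of the words of colour `0` from `x` to `y`. -/
def JumpZero (i : ι) (x y : ℕ) : Prop :=
  (∃ b c, C.Rot i x b c 0 0 0 ∧ x ≤ b ∧ x ≤ c ∧ max b c = y ∧ x < y) ∨
  (∃ c r j a s, C.Rot i x y c 0 0 r ∧ r ≠ 0 ∧ x < y ∧ C.time i < C.time j ∧
    C.Rot j y c a 0 r s ∧ x < a)

variable (C) in
/-- The `i`-th word moves the first letter of the words of colour `1` from `x` to `y`. -/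
def JumpOne (i : ι) (x y : ℕ) : Prop :=
  (∃ b c, C.Rot i x b c 1 1 1 ∧ x ≤ b ∧ x ≤ c ∧ max b c = y ∧ x < y) ∨
  (∃ h, C.Rot i h y x 0 1 1 ∧ x < y)

variable (C) in
/-- The `i`-th word is `caa` with colours `0`, `1`, `1`, and its edge `ca` occurs later on. -/
def Flat (i : ι) (a c : ℕ) : Prop :=
  C.Rot i c a a 0 1 1 ∧ a < c ∧
    ∃ j b s, C.time i < C.time j ∧ C.Rot j c a b 0 1 s ∧ a < b

theorem Rot.exists_min (h : C.Rot i a b c p p p) :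
    ∃ x y z, C.Rot i x y z p p p ∧ x ≤ y ∧ x ≤ z ∧ x < max y z := by
  have := h.not_const
  by_cases h1 : a ≤ b ∧ a ≤ c
  · exact ⟨a, b, c, h, h1.1, h1.2, by omega⟩
  by_cases h2 : b ≤ c ∧ b ≤ a
  · exact ⟨b, c, a, h.rotate, h2.1, h2.2, by omega⟩
  · exact ⟨c, a, b, h.rotate.rotate, by omega, by omega, by omega⟩

theorem Unassigned.jumpZero (hX : C.Unassigned i) (h : C.Rot i a b c 0 0 r) (hr : r ≠ 0) :
    C.JumpZero i a b := by
  obtain ⟨j, a', s, hij, hj, ha⟩ := hX.exists_later h.rotate ⟨hr, by omega⟩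
  have h1 := h.lex hj hij
  have h2 := h.color_anti h.rotate.rotate
  have h3 := h.not_const
  exact Or.inr ⟨c, r, j, a', s, h, hr, by omega, hij, hj, ha⟩

theorem Unassigned.jumpOne_or_flat (hX : C.Unassigned i) (h : C.Rot i c a b 0 1 1) :
    C.JumpOne i b a ∨ C.Flat i a c := by
  obtain ⟨j, b', s, hij, hj, hb⟩ := hX.exists_later h ⟨one_ne_zero, by omega⟩
  have h1 := h.rotate.rotate.lex hj.rotate hij
  have h2 := h.color_anti h.rotate
  have h3 := h.not_const
  rcases (show b < a ∨ b = a by omega) with hba | rfl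
  · exact Or.inl (Or.inr ⟨c, h, hba⟩)
  · exact Or.inr ⟨h, by omega, j, b', s, hij, hj, hb⟩

/-- Two rotations of colour `1` and one of a larger colour. -/
theorem Unassigned.not_one_one (hX : C.Unassigned i) (h : C.Rot i a b c 1 1 r)
    (hr : 2 ≤ r) : False := by
  obtain ⟨j, a', s, hij, hj, ha⟩ := hX.exists_later h.rotate ⟨by omega, by omega⟩
  obtain ⟨k, b', t, hik, hk, hb⟩ := hX.exists_later h.rotate.rotate ⟨by omega, by omega⟩
  have h1 := h.lex hj hij
  have h2 := h.rotate.lex hk.rotate hik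
  have h3 := h.color_anti h.rotate.rotate
  rcases C.time_trichotomy j k with hjk | rfl | hkj
  · have := hj.rotate.lex hk hjk
    omega
  · have := hj.eq_or_rotate hk
    have := h.not_const
    omega
  · have := hk.rotate.lex hj hkj
    have := h.not_const
    omega

theorem Unassigned.classify (hX : C.Unassigned i) :
    (∃ x y, C.JumpZero i x y) ∨ (∃ x y, C.JumpOne i x y) ∨ ∃ a c, C.Flat i a c := by
  obtain ⟨a, b, c, p, q, r, h⟩ := C.exists_rot i
  -- rotations with exactly one colour `0`
  have key1 : ∀ {a b c q r}, C.Rot i a b c 0 q r → q ≠ 0 → r ≠ 0 →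
      (∃ x y, C.JumpOne i x y) ∨ ∃ a c, C.Flat i a c := by
    intro a b c q r h hq hr
    by_cases hqr : q = 1 ∧ r = 1
    · obtain ⟨rfl, rfl⟩ := hqr
      exact (hX.jumpOne_or_flat h).imp (fun h => ⟨_, _, h⟩) fun h => ⟨_, _, h⟩
    · exact (hX.not_one_zero h hq ⟨hr, hqr⟩).elim
  by_cases hp : p = 0 <;> by_cases hq : q = 0 <;> by_cases hr : r = 0
  · subst hp hq hr
    obtain ⟨x, y, z, h, h1, h2, h3⟩ := h.exists_min
    exact Or.inl ⟨x, _, Or.inl ⟨y, z, h, h1, h2, rfl, h3⟩⟩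
  · subst hp hq
    exact Or.inl ⟨_, _, hX.jumpZero h hr⟩
  · subst hp hr
    exact Or.inl ⟨_, _, hX.jumpZero h.rotate.rotate hq⟩
  · subst hp
    exact Or.inr (key1 h hq hr)
  · subst hq hr
    exact Or.inl ⟨_, _, hX.jumpZero h.rotate hp⟩
  · subst hq
    exact Or.inr (key1 h.rotate hr hp)
  · subst hr
    exact Or.inr (key1 h.rotate.rotate hp hq)
  · by_cases h1 : p = 1 ∧ q = 1
    · obtain ⟨rfl, rfl⟩ := h1
      by_cases hr1 : r = 1
      · subst hr1
        obtain ⟨x, y, z, h, h1, h2, h3⟩ := h.exists_min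
        exact Or.inr (Or.inl ⟨x, _, Or.inl ⟨y, z, h, h1, h2, rfl, h3⟩⟩)
      · exact (hX.not_one_one h (by omega)).elim
    by_cases h2 : q = 1 ∧ r = 1
    · obtain ⟨rfl, rfl⟩ := h2
      exact (hX.not_one_one h.rotate (by omega)).elim
    by_cases h3 : r = 1 ∧ p = 1
    · obtain ⟨rfl, rfl⟩ := h3
      exact (hX.not_one_one h.rotate.rotate (by omega)).elim
    exact (hX.not_all_allowed h ⟨hq, h1⟩ ⟨hr, h2⟩ ⟨hp, h3⟩).elim

variable (C) in
/-- Some rotation of colour `p` of the `i`-th word begins with `x`. -/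
def Starts (i : ι) (p x : ℕ) : Prop := ∃ b c q r, C.Rot i x b c p q r

theorem Rot.starts (h : C.Rot i a b c p q r) : C.Starts i p a := ⟨_, _, _, _, h⟩

theorem Starts.le (h : C.Starts i p x) (h' : C.Starts j p y) (hij : C.time i < C.time j) :
    x ≤ y := by
  obtain ⟨_, _, _, _, h⟩ := h
  obtain ⟨_, _, _, _, h'⟩ := h'
  have := h.lex h' hij
  omega

theorem Starts.lt (h : C.Starts i p x) : x < l := by
  obtain ⟨_, _, _, _, h⟩ := h
  exact h.letter_lt

theorem JumpZero.lt (h : C.JumpZero i x y) : x < y := by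
  rcases h with ⟨b, c, h, -, -, -, hxy⟩ | ⟨c, r, j, a, s, h, -, hxy, -⟩ <;> exact hxy

theorem JumpZero.starts_left (h : C.JumpZero i x y) : C.Starts i 0 x := by
  rcases h with ⟨b, c, h, -⟩ | ⟨c, r, j, a, s, h, -⟩ <;> exact h.starts

theorem Rot.starts_max (h : C.Rot i x b c p p p) : C.Starts i p (max b c) := by
  rcases max_choice b c with h' | h' <;> rw [h']
  · exact h.rotate.starts
  · exact h.rotate.rotate.starts

theorem JumpZero.starts_right (h : C.JumpZero i x y) : C.Starts i 0 y := by
  rcases h with ⟨b, c, h, -, -, rfl, -⟩ | ⟨c, r, j, a, s, h, -⟩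
  · exact h.starts_max
  · exact h.rotate.starts

theorem JumpOne.lt (h : C.JumpOne i x y) : x < y := by
  rcases h with ⟨b, c, h, -, -, -, hxy⟩ | ⟨h, h', hxy⟩ <;> exact hxy

theorem JumpOne.starts_left (h : C.JumpOne i x y) : C.Starts i 1 x := by
  rcases h with ⟨b, c, h, -⟩ | ⟨h, h', -⟩
  · exact h.starts
  · exact h'.rotate.rotate.starts

theorem JumpOne.starts_right (h : C.JumpOne i x y) : C.Starts i 1 y := by
  rcases h with ⟨b, c, h, -, -, rfl, -⟩ | ⟨h, h', -⟩
  · exact h.starts_max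
  · exact h'.rotate.starts

theorem Flat.starts (h : C.Flat i a c) : C.Starts i 1 a := h.1.rotate.starts

theorem JumpZero.unique (h : C.JumpZero i x y) (h' : C.JumpZero j x y') : i = j := by
  rcases C.time_trichotomy i j with hij | hij | hij
  · have := h.starts_right.le h'.starts_left hij
    have := h.lt
    omega
  · exact hij
  · have := h'.starts_right.le h.starts_left hij
    have := h'.lt
    omega

theorem JumpOne.unique (h : C.JumpOne i x y) (h' : C.JumpOne j x' y) : i = j := by
  rcases C.time_trichotomy i j with hij | hij | hij
  · have := h.starts_right.le h'.starts_left hij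
    have := h'.lt
    omega
  · exact hij
  · have := h'.starts_right.le h.starts_left hij
    have := h.lt
    omega

theorem Flat.not_time_lt (h : C.Flat i a c) (h' : C.Flat j a c') : ¬ C.time i < C.time j := by
  intro hij
  obtain ⟨hi, hac, k, b, s, hik, hk, hab⟩ := h
  obtain ⟨hj, hac', -⟩ := h'
  have h1 := hi.rotate.lex hj.rotate hij
  rcases C.time_trichotomy j k with hjk | rfl | hkj
  · have := hj.lex hk hjk
    omega
  · have := hj.eq_or_rotate hk
    omega
  · have := hk.rotate.lex hj.rotate hkj
    omega

theorem Flat.unique (h : C.Flat i a c) (h' : C.Flat j a c') : i = j := by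
  rcases C.time_trichotomy i j with hij | hij | hij
  · exact (h.not_time_lt h' hij).elim
  · exact hij
  · exact (h'.not_time_lt h hij).elim

/-- A flat word at `a` followed by a jump of colour `1` from `a` to `a + 1`. -/
theorem Flat.exists_of_jumpOne (h : C.Flat i a c) (hk : C.JumpOne k x (a + 1)) :
    C.time i < C.time k ∧ ∃ y j b, C.Rot k y (a + 1) a 0 1 1 ∧
      C.time j < C.time k ∧ C.Rot j b c a 0 0 1 ∧ c ≤ b ∧ b < y := by
  obtain ⟨hi, hac, j, b, s, hij, hj, hab⟩ := id h
  have hik : C.time i < C.time k := by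
    rcases C.time_trichotomy i k with hik | rfl | hki
    · exact hik
    · obtain ⟨_, _, _, _, hk'⟩ := hk.starts_right
      have := hi.eq_or_rotate hk'
      omega
    · have := hk.starts_right.le h.starts hki
      omega
  obtain rfl : x = a := by
    have := h.starts.le hk.starts_left hik
    have := hk.lt
    omega
  have hs : s ≤ 1 := hj.rotate.color_anti hj.rotate.rotate (by omega)
  have hjk : C.time j < C.time k := by
    rcases C.time_trichotomy j k with hjk | rfl | hkj
    · exact hjk
    · rcases hk with ⟨b₁, c₁, hk, -⟩ | ⟨y, hk, -⟩
      · have := hj.eq_or_rotate hk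
        omega
      · have := hj.eq_or_rotate hk
        omega
    · have := hk.starts_right.le hj.rotate.starts hkj
      omega
  obtain rfl : s = 0 := by
    by_contra hs0
    obtain rfl : s = 1 := by omega
    have := hj.rotate.rotate.starts.le hk.starts_left hjk
    omega
  have hcb := hi.lex hj.rotate.rotate hij
  refine ⟨hik, ?_⟩
  rcases hk with ⟨b₁, c₁, hk, h1, h2, h3, -⟩ | ⟨y, hk, -⟩
  · have := hj.rotate.lex hk hjk
    omega
  · refine ⟨y, j, b, hk, hjk, hj.rotate.rotate, by omega, ?_⟩
    have h1 := hj.rotate.lex hk.rotate.rotate hjk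
    have h2 := hj.rotate.rotate.lex hk hjk
    omega

theorem Flat.not_jumpZero (h : C.Flat i a c) (hk : C.Rot k (v + 1) (a + 1) a 0 1 1) :
    ¬ C.JumpZero j v y := by
  intro hj
  obtain ⟨hik, u, m, b, hk', hmk, hm, hcb, hbu⟩ :=
    h.exists_of_jumpOne (Or.inr ⟨_, hk, Nat.lt_succ_self a⟩)
  have hac := h.2.1
  obtain rfl : u = v + 1 := by
    have := hk.eq_or_rotate hk'
    omega
  have hjk : C.time j < C.time k := by
    rcases C.time_trichotomy j k with hjk | rfl | hkj
    · exact hjk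
    · rcases hj with ⟨b₁, c₁, hj, -⟩ | ⟨c₁, r, n, a₁, s, hj, hr, -⟩
      · have := hk.eq_or_rotate hj
        omega
      · have := hk.eq_or_rotate hj
        omega
    · have := hk.starts.le hj.starts_left hkj
      omega
  obtain rfl : y = v + 1 := by
    have := hj.starts_right.le hk.starts hjk
    have := hj.lt
    omega
  have hmj : C.time m < C.time j := by
    rcases C.time_trichotomy m j with hmj | rfl | hjm
    · exact hmj
    · obtain ⟨_, _, _, _, hj'⟩ := hj.starts_right
      have := hm.eq_or_rotate hj'
      omega
    · have := hj.starts_right.le hm.starts hjm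
      omega
  have hbv := hm.starts.le hj.starts_left hmj
  rcases hj with ⟨b₁, c₁, hj, h1, h2, h3, -⟩ | ⟨c₁, r, n, a₁, s, hj, hr, -, hjn, hn, ha₁⟩
  · have h4 := hj.rotate.lex hk hjk
    have h5 := hj.rotate.rotate.lex hk hjk
    omega
  · have h4 := hj.rotate.lex hk hjk
    rcases C.time_trichotomy n k with hnk | rfl | hkn
    · have := hn.rotate.rotate.lex_zero hk hnk
      omega
    · have := hn.eq_or_rotate hk
      omega
    · have := hk.lex hn hkn
      omega

variable (C) in
/-- The value `v` of the first letter of colour `0` charged with the `i`-th word. -/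
def SlotZero (i : ι) (v : ℕ) : Prop :=
  (∃ y, C.JumpZero i v y) ∨
  ∃ a c k, C.Flat i a c ∧ C.Rot k (v + 1) (a + 1) a 0 1 1

variable (C) in
/-- The value `v` of the first letter of colour `1` charged with the `i`-th word. -/
def SlotOne (i : ι) (v : ℕ) : Prop :=
  (∃ x, C.JumpOne i x (v + 1)) ∨
  ((∃ c, C.Flat i v c) ∧ ∀ k x, ¬ C.JumpOne k x (v + 1))

theorem Unassigned.exists_slot (hX : C.Unassigned i) :
    (∃ v, C.SlotZero i v) ∨ ∃ v, C.SlotOne i v := by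
  rcases hX.classify with ⟨x, y, h⟩ | ⟨x, y, h⟩ | ⟨a, c, h⟩
  · exact Or.inl ⟨x, Or.inl ⟨y, h⟩⟩
  · obtain ⟨v, rfl⟩ : ∃ v, y = v + 1 := ⟨y - 1, by have := h.lt; omega⟩
    exact Or.inr ⟨v, Or.inl ⟨x, h⟩⟩
  · by_cases hk : ∃ k x, C.JumpOne k x (a + 1)
    · obtain ⟨k, x, hk⟩ := hk
      obtain ⟨_, y, _, _, hky, -, -, -, hy⟩ := h.exists_of_jumpOne hk
      obtain ⟨v, rfl⟩ : ∃ v, y = v + 1 := ⟨y - 1, by omega⟩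
      exact Or.inl ⟨v, Or.inr ⟨a, c, k, h, hky⟩⟩
    · exact Or.inr ⟨a, Or.inr ⟨⟨c, h⟩, fun k x h' => hk ⟨k, x, h'⟩⟩⟩

theorem SlotZero.lt (h : C.SlotZero i v) : v + 1 < l := by
  rcases h with ⟨y, h⟩ | ⟨a, c, k, -, h⟩
  · have := h.starts_right.lt
    have := h.lt
    omega
  · exact h.letter_lt

theorem SlotOne.lt (h : C.SlotOne i v) : v + 1 < l := by
  rcases h with ⟨x, h⟩ | ⟨⟨c, h⟩, -⟩
  · exact h.starts_right.lt
  · have := h.1.letter_lt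
    have := h.2.1
    omega

theorem Flat.not_lt_of_rot (h : C.Flat j a' c')
    (hk : C.Rot k (v + 1) (a + 1) a 0 1 1) {m : ι} (hm : C.Rot m (v + 1) (a' + 1) a' 0 1 1) :
    ¬ a < a' := by
  intro haa
  obtain ⟨-, u, -, b, hm', -, -, hcb, hbu⟩ :=
    h.exists_of_jumpOne (Or.inr ⟨_, hm, Nat.lt_succ_self a'⟩)
  have hu := hm.eq_or_rotate hm'
  have hkj : C.time k < C.time j := by
    rcases C.time_trichotomy k j with hkj | rfl | hjk
    · exact hkj
    · have := hk.eq_or_rotate h.1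
      omega
    · have := h.starts.le hk.rotate.rotate.starts hjk
      omega
  have := hk.starts.le h.1.starts hkj
  omega

theorem SlotZero.unique (h : C.SlotZero i v) (h' : C.SlotZero j v) : i = j := by
  rcases h with ⟨y, h⟩ | ⟨a, c, k, h, hk⟩ <;> rcases h' with ⟨y', h'⟩ | ⟨a', c', m, h', hm⟩
  · exact h.unique h'
  · exact (h'.not_jumpZero hm h).elim
  · exact (h.not_jumpZero hk h').elim
  · obtain rfl : a = a' := by
      have := h'.not_lt_of_rot hk hm
      have := h.not_lt_of_rot hm hk
      omega
    exact h.unique h'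

theorem SlotOne.unique (h : C.SlotOne i v) (h' : C.SlotOne j v) : i = j := by
  rcases h with ⟨x, h⟩ | ⟨⟨c, h⟩, hn⟩ <;> rcases h' with ⟨x', h'⟩ | ⟨⟨c', h'⟩, hn'⟩
  · exact h.unique h'
  · exact (hn' _ _ h).elim
  · exact (hn _ _ h').elim
  · exact h.unique h'

variable (C) in
/-- The labels `(p, q, s)` charged with the `i`-th word. -/
def Label (i : ι) (p q s : ℕ) : Prop :=
  (Allowed p q ∧ ∃ a b, C.Edge i p q a b ∧ C.Final i p q a b ∧ s = a + b) ∨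
  (p = 1 ∧ q = 1 ∧ (C.SlotZero i s ∨ ∃ v, C.SlotOne i v ∧ s = l - 1 + v))

theorem exists_label (C : ColoredWords ι l K) (hK : 2 ≤ K) (i : ι) :
    ∃ p q s, C.Label i p q s ∧ p < K ∧ 1 ≤ q ∧ q < K ∧ s < 2 * l - 1 := by
  by_cases hX : C.Unassigned i
  · rcases hX.exists_slot with ⟨v, h⟩ | ⟨v, h⟩
    · have := h.lt
      exact ⟨1, 1, v, Or.inr ⟨rfl, rfl, Or.inl h⟩, by omega, by omega, by omega, by omega⟩
    · have := h.lt
      exact ⟨1, 1, l - 1 + v, Or.inr ⟨rfl, rfl, Or.inr ⟨v, h, rfl⟩⟩,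
        by omega, by omega, by omega, by omega⟩
  · simp only [Unassigned, not_forall, not_not] at hX
    obtain ⟨p, q, a, b, hpq, he, hf⟩ := hX
    obtain ⟨c, r, h⟩ := id he
    have h1 := h.letter_lt
    have h2 := h.rotate.letter_lt
    exact ⟨p, q, a + b, Or.inl ⟨hpq, a, b, he, hf, rfl⟩, h.color_lt,
      Nat.one_le_iff_ne_zero.2 hpq.1, h.rotate.color_lt, by omega⟩

theorem Final.not_time_lt (hf : C.Final i p q a b) (he : C.Edge i p q a b)
    (he' : C.Edge j p q a' b') (hs : a + b = a' + b') : ¬ C.time i < C.time j := by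
  intro hij
  obtain ⟨c, r, h⟩ := he
  obtain ⟨c', r', h'⟩ := id he'
  have h1 := h.starts.le h'.starts hij
  have h2 := h.rotate.starts.le h'.rotate.starts hij
  obtain rfl : a = a' := by omega
  obtain rfl : b = b' := by omega
  exact hf j hij he'

theorem Label.unique {s : ℕ} (h : C.Label i p q s) (h' : C.Label j p q s) : i = j := by
  rcases h with ⟨hpq, a, b, he, hf, hs⟩ | ⟨hp, hq, h⟩ <;>
    rcases h' with ⟨hpq', a', b', he', hf', hs'⟩ | ⟨hp', hq', h'⟩
  · rcases C.time_trichotomy i j with hij | hij | hij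
    · exact (hf.not_time_lt he he' (by omega) hij).elim
    · exact hij
    · exact (hf'.not_time_lt he' he (by omega) hij).elim
  · exact (hpq.2 ⟨hp', hq'⟩).elim
  · exact (hpq'.2 ⟨hp, hq⟩).elim
  · rcases h with h | ⟨v, h, hv⟩ <;> rcases h' with h' | ⟨v', h', hv'⟩
    · exact h.unique h'
    · have := h.lt
      omega
    · have := h'.lt
      omega
    · obtain rfl : v = v' := by omega
      exact h.unique h'

theorem card_le [Fintype ι] (C : ColoredWords ι l K) (hK : 2 ≤ K) :
    Fintype.card ι ≤ (2 * l - 1) * K * (K - 1) := by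
  choose p q s h hp hq hq' hs using C.exists_label hK
  have := Finset.card_le_card_of_injOn (s := Finset.univ)
    (t := Finset.range (2 * l - 1) ×ˢ Finset.range K ×ˢ Finset.Ico 1 K)
    (fun i => (s i, p i, q i)) (by intro i _; simp [hp, hq, hq', hs]) (by
      intro i _ j _ hij
      simp only [Prod.mk.injEq] at hij
      obtain ⟨h1, h2, h3⟩ := hij
      have hj := h j
      rw [← h1, ← h2, ← h3] at hj
      exact (h i).unique hj)
  simpa [mul_assoc] using this

end ColoredWords

section Words

variable {α : Type*}

theorem length_wpow (z : List α) (k : ℕ) : (wpow z k).length = k * z.length := by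
  induction k with
  | zero => simp [wpow]
  | succ k ih => simp [wpow, ih, Nat.succ_mul, Nat.add_comm]

theorem wpow_append_succ (x y : List α) (k : ℕ) :
    wpow (x ++ y) (k + 1) = x ++ wpow (y ++ x) k ++ y := by
  induction k with
  | zero => simp [wpow]
  | succ k ih =>
    rw [wpow, ih]
    simp [wpow]

theorem wpow_prefix_wpow (z : List α) {k k' : ℕ} (h : k ≤ k') : wpow z k <+: wpow z k' := by
  induction k generalizing k' with
  | zero => exact List.nil_prefix
  | succ k ih =>
    obtain ⟨k', rfl⟩ : ∃ t, k' = t + 1 := ⟨k' - 1, by omega⟩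
    exact (List.prefix_append_right_inj z).2 (ih (by omega))

theorem noncyclic_triple {a b c : α} : Noncyclic [a, b, c] ↔ ¬ (a = b ∧ b = c) := by
  constructor
  · rintro ⟨-, h⟩ ⟨rfl, rfl⟩
    exact h [a] 3 (by norm_num) rfl
  · refine fun h => ⟨by simp, fun v k hk hv => h ?_⟩
    have hlen := congrArg List.length hv
    rw [length_wpow, List.length_cons, List.length_cons, List.length_singleton] at hlen
    have hk3 : k = 3 :=
      ((Nat.dvd_prime Nat.prime_three).1 (Dvd.intro _ hlen.symm)).resolve_left (by omega)
    subst hk3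
    obtain ⟨x, rfl⟩ := List.length_eq_one_iff.1 (show v.length = 1 by omega)
    simp only [wpow, List.cons_append, List.nil_append, List.cons.injEq, and_true] at hv
    exact ⟨hv.1.trans hv.2.1.symm, hv.2.1.trans hv.2.2.symm⟩

theorem OccursAt.wpow_rotate_prefix {W z : List α} {m p s k : ℕ} (h : OccursAt W (wpow z m) p)
    (hs : s ≤ z.length) (hk : k < m) : wpow (z.rotate s) k <+: W.drop (p + s) := by
  obtain ⟨pre, suf, rfl, rfl⟩ := h
  obtain ⟨m, rfl⟩ : ∃ t, m = t + 1 := ⟨m - 1, by omega⟩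
  refine (wpow_prefix_wpow _ (Nat.lt_succ_iff.1 hk)).trans ?_
  have hz : wpow z (m + 1) = z.take s ++ wpow (z.rotate s) m ++ z.drop s := by
    rw [List.rotate_eq_drop_append_take hs, ← wpow_append_succ, List.take_append_drop]
  have hl : pre.length + s = (pre ++ z.take s).length := by simp [hs]
  refine ⟨z.drop s ++ suf, ?_⟩
  rw [hz, hl, ← List.append_assoc pre, ← List.append_assoc pre, List.append_assoc,
    List.append_assoc, List.drop_left]

theorem OccursAt.add_length_le {W u : List α} {p : ℕ} (h : OccursAt W u p) :
    p + u.length ≤ W.length := by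
  obtain ⟨pre, suf, rfl, rfl⟩ := h
  simp

theorem flatten_ofFn_take_drop (W : List α) (P : ℕ → ℕ) (n : ℕ)
    (hP : ∀ k < n, P k ≤ P (k + 1)) :
    P 0 ≤ P n ∧ (List.ofFn fun k : Fin n => (W.drop (P k)).take (P (k + 1) - P k)).flatten =
      (W.drop (P 0)).take (P n - P 0) := by
  induction n with
  | zero => simp
  | succ n ih =>
    obtain ⟨h0, ih⟩ := ih fun k hk => hP k (by omega)
    have h1 := hP n (by omega)
    refine ⟨h0.trans h1, ?_⟩
    rw [List.ofFn_succ', List.concat_eq_append, List.flatten_append]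
    simp only [Fin.val_castSucc, Fin.val_last, List.flatten_singleton, ih]
    rw [show P (n + 1) - P 0 = (P n - P 0) + (P (n + 1) - P n) by omega, List.take_add,
      List.drop_drop, Nat.add_sub_cancel' h0]

variable [LinearOrder α]

theorem WordGt.irrefl (u : List α) : ¬ WordGt u u := fun h => h.2 List.prefix_rfl

theorem WordGt.append {u v : List α} (h : WordGt u v) (x y : List α) :
    WordGt (u ++ x) (v ++ y) := by
  obtain ⟨hlex, hpre⟩ := h
  induction hlex with
  | nil => exact (hpre List.nil_prefix).elim
  | rel h =>
    refine ⟨List.Lex.rel h, fun hp => h.ne ?_⟩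
    exact (List.cons_prefix_cons.1 hp).1
  | cons _ ih =>
    obtain ⟨h1, h2⟩ := ih fun hp => hpre (List.cons_prefix_cons.2 ⟨rfl, hp⟩)
    exact ⟨List.Lex.cons h1, fun hp => h2 (List.cons_prefix_cons.1 hp).2⟩

theorem wordGt_triple {l : ℕ} {a b c a' b' c' : Fin l} (h : Lex3 a b c a' b' c') :
    WordGt [a', b', c'] [a, b, c] := by
  constructor
  · rcases h with h | ⟨h1, h | ⟨h2, h3⟩⟩
    · exact List.Lex.rel (Fin.lt_def.2 h)
    · obtain rfl := Fin.ext h1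
      exact List.Lex.cons (List.Lex.rel (Fin.lt_def.2 h))
    · obtain rfl := Fin.ext h1
      obtain rfl := Fin.ext h2
      exact List.Lex.cons (List.Lex.cons (List.Lex.rel (Fin.lt_def.2 h3)))
  · intro hp
    have := hp.eq_of_length rfl
    simp only [List.cons.injEq, and_true] at this
    obtain ⟨rfl, rfl, rfl⟩ := this
    omega

/-- A word is strongly divisible once suitable powers start at sufficiently separated positions. -/
theorem StronglyNDivisible.of_positions {W : List α} {n : ℕ} {Z : Set (List α)} (P : ℕ → ℕ)
    (z : Fin n → List α) (hn : n ≠ 0) (hPn : P n = W.length) (hz : ∀ k, z k ∈ Z)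
    (hne : ∀ k, z k ≠ []) (hP : ∀ k : Fin n, P k + 2 * n * (z k).length ≤ P (k + 1))
    (hpre : ∀ k : Fin n, wpow (z k) (2 * n) <+: W.drop (P k))
    (hgt : ∀ i j, i < j → WordGt (z i) (z j)) : StronglyNDivisible W n Z := by
  have hmono : ∀ k < n, P k ≤ P (k + 1) := fun k hk =>
    (Nat.le_add_right _ _).trans (hP ⟨k, hk⟩)
  obtain ⟨h0, hflat⟩ := flatten_ofFn_take_drop W P n hmono
  have hpow : ∀ k : Fin n, wpow (z k) (2 * n) <+: (W.drop (P k)).take (P (k + 1) - P k) := by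
    intro k
    refine List.prefix_take_iff.2 ⟨hpre k, ?_⟩
    rw [length_wpow]
    have := hP k
    omega
  have hfst : ∀ k : Fin n, z k <+: (W.drop (P k)).take (P (k + 1) - P k) := by
    intro k
    refine List.IsPrefix.trans ?_ (hpow k)
    obtain ⟨t, ht⟩ : ∃ t, 2 * n = t + 1 := ⟨2 * n - 1, by omega⟩
    rw [ht, wpow]
    exact List.prefix_append _ _
  refine ⟨W.take (P 0), _, z, ?_, fun k hk => ?_, fun i j hij => ?_,
    fun k => ⟨hz k, hpow k⟩, fun i j hij => ?_⟩
  · rw [hflat, hPn, ← List.length_drop, List.take_length, List.take_append_drop]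
  · have := hfst k
    rw [hk, List.prefix_nil] at this
    exact hne k this
  · obtain ⟨x, hx⟩ := hfst i
    obtain ⟨y, hy⟩ := hfst j
    rw [← hx, ← hy]
    exact (hgt i j hij).append x y
  · by_contra hne'
    rcases lt_or_gt_of_ne hne' with h | h
    · exact WordGt.irrefl (z i) (hij.symm ▸ hgt i j h)
    · exact WordGt.irrefl (z i) (hij.symm ▸ hgt j i h)

end Words

section Chains

variable {β : Type*} (r : β → β → Prop)

/-- There is a chain of `m + 1` elements for `r` that ends at `x`. -/
def HasChain : ℕ → β → Prop
  | 0, _ => True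
  | m + 1, x => ∃ y, r y x ∧ HasChain m y

variable {r}

theorem HasChain.of_succ {m : ℕ} {x : β} (h : HasChain r (m + 1) x) : HasChain r m x := by
  induction m generalizing x with
  | zero => trivial
  | succ m ih =>
    obtain ⟨y, hy, h⟩ := h
    exact ⟨y, hy, ih h⟩

theorem HasChain.of_le {m m' : ℕ} {x : β} (h : HasChain r m' x) (hm : m ≤ m') :
    HasChain r m x := by
  induction hm with
  | refl => exact h
  | step _ ih => exact ih h.of_succ

theorem HasChain.mono {m : ℕ} {x x' : β} (h : HasChain r m x) (hx : ∀ y, r y x → r y x') :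
    HasChain r m x' := by
  cases m with
  | zero => trivial
  | succ m =>
    obtain ⟨y, hy, h⟩ := h
    exact ⟨y, hx y hy, h⟩

theorem HasChain.exists_seq (hr : ∀ x y z, r x y → r y z → r x z) {m : ℕ} {x : β}
    (h : HasChain r m x) :
    ∃ g : ℕ → β, g m = x ∧ ∀ a b, a < b → b ≤ m → r (g a) (g b) := by
  induction m generalizing x with
  | zero => exact ⟨fun _ => x, rfl, fun a b h h' => by omega⟩
  | succ m ih =>
    obtain ⟨y, hy, h⟩ := h
    obtain ⟨g, hg, hgr⟩ := ih h
    refine ⟨fun k => if k ≤ m then g k else x, by simp, fun a b hab hb => ?_⟩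
    simp only [show a ≤ m by omega, if_true]
    split_ifs with hbm
    · exact hgr a b hab hbm
    · rcases (show a ≤ m by omega).eq_or_lt with rfl | ham
      · rwa [hg]
      · exact hr _ _ _ (hgr a m ham le_rfl) (hg ▸ hy)

open Classical in
/-- The largest `m ≤ M` such that a chain of `m + 1` elements ends at `x`. -/
noncomputable def chainRank (r : β → β → Prop) (M : ℕ) (x : β) : ℕ :=
  Nat.findGreatest (fun m => HasChain r m x) M

theorem chainRank_le (M : ℕ) (x : β) : chainRank r M x ≤ M := by
  classical
  exact Nat.findGreatest_le M

theorem hasChain_chainRank (M : ℕ) (x : β) : HasChain r (chainRank r M x) x := by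
  classical
  exact Nat.findGreatest_spec (P := fun m => HasChain r m x) (Nat.zero_le M) trivial

theorem HasChain.le_chainRank {M m : ℕ} {x : β} (h : HasChain r m x)
    (hM : ¬ HasChain r (M + 1) x) : m ≤ chainRank r M x := by
  classical
  refine Nat.le_findGreatest ?_ h
  by_contra hm
  exact hM (h.of_le (by omega))

end Chains

section Rotations

/-- The rotation of `x` at `s` is lexicographically smaller than the rotation of `y` at `t`. -/
abbrev RotLt {l : ℕ} (x y : Fin 3 → Fin l) (s t : Fin 3) : Prop :=
  Lex3 (x s) (x (s + 1)) (x (s + 2)) (y t) (y (t + 1)) (y (t + 2))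

variable {l : ℕ}

theorem rotate_triple (x : Fin 3 → Fin l) (s : Fin 3) :
    [x 0, x 1, x 2].rotate s = [x s, x (s + 1), x (s + 2)] := by
  fin_cases s <;> rfl

theorem rotLt_or_rotLt {x y : Fin 3 → Fin l}
    (h : ¬ List.IsRotated [x 0, x 1, x 2] [y 0, y 1, y 2]) (s t : Fin 3) :
    RotLt x y s t ∨ RotLt y x t s := by
  by_contra hn
  have h0 : x s = y t := by apply Fin.ext; omega
  have h1 : x (s + 1) = y (t + 1) := by apply Fin.ext; omega
  have h2 : x (s + 2) = y (t + 2) := by apply Fin.ext; omega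
  refine h ?_
  have hx : List.IsRotated [x 0, x 1, x 2] ([x 0, x 1, x 2].rotate s) := ⟨s, rfl⟩
  have hy : List.IsRotated [y 0, y 1, y 2] ([y 0, y 1, y 2].rotate t) := ⟨t, rfl⟩
  rw [rotate_triple] at hx hy
  rw [h0, h1, h2] at hx
  exact hx.trans hy.symm

theorem RotLt.trans {x y w : Fin 3 → Fin l} {s t v : Fin 3} (h : RotLt x y s t)
    (h' : RotLt y w t v) : RotLt x w s v := by
  unfold RotLt at *
  omega

/-- Rotation `p` lies at an earlier time than rotation `q` and exceeds it. -/
def Before {ι : Type*} (u : ι → Fin 3 → Fin l) (time : ι → ℕ) (p q : ι × Fin 3) : Prop :=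
  time p.1 < time q.1 ∧ RotLt (u q.1) (u p.1) q.2 p.2

theorem Before.trans {ι : Type*} {u : ι → Fin 3 → Fin l} {time : ι → ℕ} (p q w : ι × Fin 3)
    (h : Before u time p q) (h' : Before u time q w) : Before u time p w :=
  ⟨h.1.trans h'.1, h'.2.trans h.2⟩

/-- Colouring rotations by the longest chain of larger earlier rotations. -/
noncomputable def ColoredWords.ofChains {ι : Type*} (u : ι → Fin 3 → Fin l) (time : ι → ℕ)
    (htime : Function.Injective time) (M : ℕ)
    (hconst : ∀ i, ¬ (u i 0 = u i 1 ∧ u i 1 = u i 2))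
    (hrot : ∀ i j, i ≠ j → ¬ List.IsRotated [u i 0, u i 1, u i 2] [u j 0, u j 1, u j 2])
    (hM : ∀ p, ¬ HasChain (Before u time) (M + 1) p) : ColoredWords ι l (M + 1) :=
  have key : ∀ i j s t, time i < time j → RotLt (u j) (u i) t s →
      chainRank (Before u time) M (i, s) < chainRank (Before u time) M (j, t) :=
    fun i j s t hij h =>
      HasChain.le_chainRank (m := chainRank (Before u time) M (i, s) + 1)
        ⟨(i, s), ⟨hij, h⟩, hasChain_chainRank M (i, s)⟩ (hM _)
  have lex : ∀ i j s t, time i < time j →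
      chainRank (Before u time) M (j, t) ≤ chainRank (Before u time) M (i, s) →
      RotLt (u i) (u j) s t := fun i j s t hij h =>
    (rotLt_or_rotLt (hrot i j fun he => by subst he; omega) s t).resolve_right fun h' =>
      (key i j s t hij h').not_ge h
  { time := time
    letter := fun i s => u i s
    color := fun i s => chainRank (Before u time) M (i, s)
    time_injective := htime
    letter_lt := fun i s => (u i s).isLt
    color_lt := fun _ _ => Nat.lt_succ_of_le (chainRank_le _ _)
    not_const := fun i h => hconst i ⟨Fin.ext h.1, Fin.ext h.2⟩
    lex_of_color_eq := fun i j s t hij h => lex i j s t hij h.ge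
    lex_of_color_zero := fun i j s t hij h => lex i j s t hij (h.le.trans (Nat.zero_le _))
    color_anti := fun i s t h =>
      ((hasChain_chainRank M (i, t)).mono fun p hp =>
        ⟨hp.1, RotLt.trans h hp.2⟩).le_chainRank (hM _) }

end Rotations

theorem not_hasChain_before {l n N : ℕ} (hn : n ≠ 0) {W : List (Fin l)}
    (hndiv : ¬ StronglyNDivisible W n {z : List (Fin l) | Noncyclic z ∧ z.length = 3})
    {u : Fin N → Fin 3 → Fin l} {m pos : Fin N → ℕ} (hm : ∀ i, 2 * n < m i)
    (hconst : ∀ i, ¬ (u i 0 = u i 1 ∧ u i 1 = u i 2))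
    (hocc : ∀ i, OccursAt W (wpow [u i 0, u i 1, u i 2] (m i)) (pos i))
    (hdisj : ∀ i j, pos i < pos j → pos i + m i * 3 ≤ pos j) (p : Fin N × Fin 3) :
    ¬ HasChain (Before u pos) (n - 1) p := by
  intro h
  obtain ⟨g, -, hg⟩ := h.exists_seq Before.trans
  refine hndiv (.of_positions (fun k => if k < n then pos (g k).1 + (g k).2 else W.length)
    (fun k => [u (g k).1 (g k).2, u (g k).1 ((g k).2 + 1), u (g k).1 ((g k).2 + 2)]) hn (by simp)
    (fun k => ⟨?_, rfl⟩) (by simp) (fun k => ?_) (fun k => ?_) fun i j hij => ?_)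
  · rw [noncyclic_triple]
    have := hconst (g k).1
    generalize (g k).2 = s
    contrapose! this
    fin_cases s <;> simp_all
  · have hk := k.isLt
    have h1 := hm (g k).1
    have h2 := (g k).2.isLt
    simp only [hk, if_true, List.length_cons, List.length_nil]
    split_ifs with hk1
    · have := hdisj _ _ (hg k (k + 1) (by omega) (by omega)).1
      omega
    · have := (hocc (g k).1).add_length_le
      rw [length_wpow] at this
      simp only [List.length_cons, List.length_nil] at this
      omega
  · simp only [k.isLt, if_true]
    rw [← rotate_triple]
    exact (hocc (g k).1).wpow_rotate_prefix (g k).2.isLt.le (hm _)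
  · exact wordGt_triple (hg i j hij (by omega)).2

/-- Over an `l`-letter alphabet (`l ≥ 1`, `n ≥ 3`), if `W` is not strongly
`n`-divisible over the set of noncyclic words of length 3, then any family of
pairwise disjoint occurrences in `W` of subwords `z^m` with `z` noncyclic of
length 3, `m > 2n`, and pairwise non-rotation-equivalent periods, has at most
`(2l−1)(n−1)(n−2)` members. -/
theorem selective_height_period_three_upper (l n : ℕ) (hl : 1 ≤ l) (hn : 3 ≤ n)
    (W : List (Fin l)) (hW : W ≠ [])
    (hndiv : ¬ StronglyNDivisible W n {z : List (Fin l) | Noncyclic z ∧ z.length = 3})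
    (N : ℕ) (z : Fin N → List (Fin l)) (m : Fin N → ℕ) (pos : Fin N → ℕ)
    (hz : ∀ i, Noncyclic (z i) ∧ (z i).length = 3)
    (hm : ∀ i, 2 * n < m i)
    (hocc : ∀ i, OccursAt W (wpow (z i) (m i)) (pos i))
    (hdisj : ∀ i j, i ≠ j →
      pos i + (wpow (z i) (m i)).length ≤ pos j ∨
      pos j + (wpow (z j) (m j)).length ≤ pos i)
    (hrot : ∀ i j, i ≠ j → ¬ List.IsRotated (z i) (z j)) :
    N ≤ (2 * l - 1) * (n - 1) * (n - 2) := by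
  have hex : ∀ i, ∃ u : Fin 3 → Fin l, z i = [u 0, u 1, u 2] := fun i => by
    obtain ⟨a, b, c, h⟩ := List.length_eq_three.1 (hz i).2
    exact ⟨![a, b, c], h⟩
  choose u hu using hex
  simp only [hu] at hz hocc hdisj hrot
  simp only [length_wpow, List.length_cons, List.length_nil] at hdisj
  have hinj : Function.Injective pos := fun i j hij => by
    by_contra hne
    have h1 := hm i
    have h2 := hm j
    have := hdisj i j hne
    omega
  have hsep : ∀ i j, pos i < pos j → pos i + m i * 3 ≤ pos j := fun i j hij => by
    have h1 := hm j
    have := hdisj i j (fun h => by subst h; omega)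
    omega
  have hconst := fun i => noncyclic_triple.1 (hz i).1
  obtain ⟨M, rfl⟩ : ∃ M, n = M + 2 := ⟨n - 2, by omega⟩
  have := (ColoredWords.ofChains u pos hinj M hconst hrot
    (not_hasChain_before (by omega) hndiv hm hconst hocc hsep)).card_le (by omega)
  simpa using this
end

section
/- Let n ≥ 2 be an integer and let x be a noncyclic (primitive) word of length at least n over a finite linearly ordered alphabet. Then the word x^{2n} is n-divisible. -/
theorem wpow_add {α : Type*} (z : List α) (i j : ℕ) :
    wpow z (i + j) = wpow z i ++ wpow z j := by
  induction i with
  | zero => simp [wpow]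
  | succ i ih => simp [Nat.succ_add, wpow, ih]

/-- Two nonempty commuting words are powers of a common word. -/
theorem exists_wpow_of_append_comm {α : Type*} (u v : List α) (hu : u ≠ []) (hv : v ≠ [])
    (h : u ++ v = v ++ u) :
    ∃ (w : List α) (i j : ℕ), 1 ≤ i ∧ 1 ≤ j ∧ u = wpow w i ∧ v = wpow w j := by
  induction hN : u.length + v.length using Nat.strong_induction_on generalizing u v with
  | _ N ih =>
    wlog huv : u.length ≤ v.length generalizing u v
    · obtain ⟨w, i, j, hi, hj, h1, h2⟩ := this v u hv hu h.symm (by omega) (by omega)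
      exact ⟨w, j, i, hj, hi, h2, h1⟩
    obtain ⟨v', rfl⟩ : u <+: v :=
      List.prefix_of_prefix_length_le (List.prefix_append u v) (h ▸ List.prefix_append v u) huv
    have hcomm : u ++ v' = v' ++ u := by simpa using h
    by_cases hv' : v' = []
    · exact ⟨u, 1, 1, le_rfl, le_rfl, by simp [wpow], by simp [wpow, hv']⟩
    · have hlen := List.length_pos_iff.2 hu
      obtain ⟨w, i, j, hi, hj, h1, h2⟩ :=
        ih _ (by simp only [List.length_append] at hN; omega) u v' hu hv' hcomm rfl
      exact ⟨w, i, i + j, hi, by omega, h1, by rw [wpow_add, ← h1, ← h2]⟩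

theorem Noncyclic.rotate_ne {α : Type*} {x : List α} (hx : Noncyclic x) {k : ℕ} (hk : 0 < k)
    (hkx : k < x.length) : x.rotate k ≠ x := by
  intro h
  rw [List.rotate_eq_drop_append_take hkx.le] at h
  obtain ⟨w, i, j, hi, hj, h1, h2⟩ := exists_wpow_of_append_comm (x.take k) (x.drop k)
    (by rw [← List.length_pos_iff, List.length_take]; omega)
    (by rw [← List.length_pos_iff, List.length_drop]; omega)
    (by rw [h, List.take_append_drop])
  refine hx.2 w (i + j) (by omega) ?_
  rw [wpow_add, ← h1, ← h2, List.take_append_drop]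

theorem Noncyclic.rotate_injOn {α : Type*} {x : List α} (hx : Noncyclic x) :
    Set.InjOn x.rotate (Set.Iio x.length) := by
  intro a ha b hb hab
  wlog hlt : a < b generalizing a b
  · rcases eq_or_lt_of_le (not_lt.1 hlt) with h | h
    · exact h.symm
    · exact (this hb ha hab.symm h).symm
  simp only [Set.mem_Iio] at ha hb
  refine absurd ?_ (hx.rotate_ne (k := b - a) (by omega) (by omega))
  apply List.rotate_injective a
  beta_reduce
  rw [List.rotate_rotate, Nat.sub_add_cancel hlt.le]
  exact hab.symm

theorem wordGt_append_of_lt {α : Type*} [LinearOrder α] {u v : List α}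
    (hlen : u.length = v.length) (h : v < u) (s t : List α) : WordGt (u ++ s) (v ++ t) := by
  induction u generalizing v with
  | nil =>
    obtain rfl : v = [] := List.length_eq_zero_iff.1 hlen.symm
    exact absurd h (lt_irrefl _)
  | cons a u ih =>
    obtain _ | ⟨b, v⟩ := v
    · simp at hlen
    · rcases List.cons_lt_cons_iff.1 h with hab | ⟨rfl, hvu⟩
      · refine ⟨List.Lex.rel hab, fun hp => hab.ne ?_⟩
        exact (List.cons_prefix_cons.1 hp).1
      · obtain ⟨h1, h2⟩ := ih (by simpa using hlen) hvu
        exact ⟨List.Lex.cons h1, fun hp => h2 (List.cons_prefix_cons.1 hp).2⟩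

/-- Cut points placed in every second period of a power of `x` factor that power. -/
theorem take_append_flatten_eq_wpow {α : Type*} (x : List α) (n : ℕ) (d : ℕ → ℕ) :
    x.take (d 0) ++
      (List.ofFn fun i : Fin n => x.drop (d i) ++ x ++ x.take (d (i + 1))).flatten =
      wpow x (2 * n) ++ x.take (d n) := by
  induction n generalizing d with
  | zero => simp [wpow]
  | succ n ih =>
    have h := ih fun i => d (i + 1)
    simp only [List.append_assoc] at h
    simp [List.ofFn_succ, Nat.mul_succ, wpow, ← h, ← List.append_assoc (x.take _) (x.drop _)]

/-- There are `n` cut points at which the rotations of `x` strictly decrease. -/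
theorem Noncyclic.exists_rotate_strictAnti {α : Type*} [LinearOrder α] {x : List α}
    (hx : Noncyclic x) {n : ℕ} (hlen : n ≤ x.length) :
    ∃ d : Fin n → ℕ, (∀ i, d i < x.length) ∧ StrictAnti fun i => x.rotate (d i) := by
  obtain ⟨S, hS, hcard⟩ := Finset.exists_subset_card_eq
    (s := (Finset.range x.length).image x.rotate) (n := n) (by
      rwa [Finset.card_image_of_injOn (by simpa using hx.rotate_injOn), Finset.card_range])
  have hmem (i : Fin n) : ∃ k < x.length, x.rotate k = S.orderEmbOfFin hcard i.rev := by
    simpa using hS (S.orderEmbOfFin_mem hcard i.rev)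
  choose d hd hrot using hmem
  refine ⟨d, hd, fun i j hij => ?_⟩
  simp only [hrot]
  exact (S.orderEmbOfFin hcard).strictMono (Fin.rev_lt_rev.2 hij)

/-- If `x` is a noncyclic (primitive) word of length at least `n ≥ 2` over a
finite linearly ordered alphabet, then `x^{2n}` is `n`-divisible. -/
theorem pow_n_divisible_of_long_primitive {α : Type*} [LinearOrder α]
    [Fintype α] (n : ℕ) (hn : 2 ≤ n) (x : List α) (hx : Noncyclic x)
    (hlen : n ≤ x.length) :
    NDivisible (wpow x (2 * n)) n := by
  obtain ⟨d, hd, hanti⟩ := hx.exists_rotate_strictAnti hlen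
  let e : ℕ → ℕ := fun i => if h : i < n then d ⟨i, h⟩ else 0
  have he (i : Fin n) : e i = d i := by simp [e]
  refine ⟨x.take (e 0), fun i => x.drop (e i) ++ x ++ x.take (e (i + 1)), ?_, ?_, ?_⟩
  · rw [take_append_flatten_eq_wpow]
    simp [e]
  · simp [hx.1]
  · have hsplit (i : Fin n) (t : List α) :
        x.drop (e i) ++ x ++ t = x.rotate (d i) ++ (x.drop (d i) ++ t) := by
      rw [he, List.rotate_eq_drop_append_take (hd i).le]
      simp [← List.append_assoc (x.take _) (x.drop _)]
    intro i j hij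
    simp only [hsplit]
    exact wordGt_append_of_lt (by simp) (hanti hij) _ _
end
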